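/- Let 1 < p < ∞ and let Ψ be a Young function. Then the Orlicz maximal operator M_Ψ is bounded on L^p(ℝⁿ), i.e. there is a constant C with ‖M_Ψ f‖_{L^p(ℝⁿ)} ≤ C ‖f‖_{L^p(ℝⁿ)} for all f ∈ L^p(ℝⁿ), if and only if Ψ satisfies the B_p condition, ∫₁^∞ Ψ(t) t^{−p} dt/t < ∞. -/

import Mathlib

open MeasureTheory Filter
open scoped ENNReal Classical

noncomputable section

abbrev Rn (n : ℕ) := Fin n → ℝ

/-- A cube in `ℝⁿ` with sides parallel to the coordinate axes. -/
def IsCube {n : ℕ} (Q : Set (Rn n)) : Prop :=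
  ∃ (c : Rn n) (h : ℝ), 0 < h ∧ Q = Set.univ.pi fun i => Set.Icc (c i) (c i + h)

/-- The average `⨍_Q f = |Q|⁻¹ ∫_Q f`. -/
def cubeAvg {n : ℕ} (Q : Set (Rn n)) (f : Rn n → ℝ) : ℝ :=
  (volume Q).toReal⁻¹ * ∫ x in Q, f x

/-- A weight: a non-negative locally integrable function. -/
def IsWeight {n : ℕ} (w : Rn n → ℝ) : Prop :=
  (∀ x, 0 ≤ w x) ∧ LocallyIntegrable w volume

/-- Weighted `L^p` norm `(∫ |f|^p w)^{1/p}`. -/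
def lpNorm {n : ℕ} (p : ℝ) (w : Rn n → ℝ) (f : Rn n → ℝ) : ℝ≥0∞ :=
  (∫⁻ x, ENNReal.ofReal (|f x| ^ p * w x)) ^ (1 / p)

/-- Weighted `L^p` norm of an `ℝ≥0∞`-valued function. -/
def elpNorm {n : ℕ} (p : ℝ) (w : Rn n → ℝ) (F : Rn n → ℝ≥0∞) : ℝ≥0∞ :=
  (∫⁻ x, F x ^ p * ENNReal.ofReal (w x)) ^ (1 / p)

/-- A Young function: convex, increasing, continuous on `[0,∞)`, vanishing at `0`,
and superlinear at infinity. -/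
def IsYoung (Φ : ℝ → ℝ) : Prop :=
  ConvexOn ℝ (Set.Ici 0) Φ ∧ StrictMonoOn Φ (Set.Ici 0) ∧ ContinuousOn Φ (Set.Ici 0) ∧
    Φ 0 = 0 ∧ Tendsto (fun t => Φ t / t) atTop atTop

/-- The complementary Young function `Φ̄(s) = sup_{t ≥ 0} (st - Φ(t))`. -/
def youngConj (Φ : ℝ → ℝ) (s : ℝ) : ℝ :=
  sSup {r : ℝ | ∃ t : ℝ, 0 ≤ t ∧ r = s * t - Φ t}

/-- Generalized inverse `Φ⁻¹(t) = inf {s ≥ 0 : Φ(s) ≥ t}`. -/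
def youngInv (Φ : ℝ → ℝ) (t : ℝ) : ℝ := sInf {s : ℝ | 0 ≤ s ∧ t ≤ Φ s}

/-- The `B_p` condition: `∫₁^∞ Ψ(t)/t^p dt/t < ∞`. -/
def BClass (p : ℝ) (Ψ : ℝ → ℝ) : Prop :=
  ∫⁻ t in Set.Ioi (1 : ℝ), ENNReal.ofReal (Ψ t / t ^ p / t) < ⊤

/-- The conjugate exponent `r' = r/(r-1)`. -/
def conjExp (r : ℝ) : ℝ := r / (r - 1)

/-- The localized Orlicz norm `‖f‖_{Φ,Q}`. -/
def orliczNorm {n : ℕ} (Φ : ℝ → ℝ) (f : Rn n → ℝ) (Q : Set (Rn n)) : ℝ :=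
  sInf {lam : ℝ | 0 < lam ∧ cubeAvg Q (fun x => Φ (|f x| / lam)) ≤ 1}

/-- `w ∈ RH_Ψ` with constant `c`: `‖w‖_{Ψ,Q} ≤ c ⨍_Q w` for all cubes `Q`. -/
def RHOrliczWith {n : ℕ} (Ψ : ℝ → ℝ) (w : Rn n → ℝ) (c : ℝ) : Prop :=
  ∀ Q : Set (Rn n), IsCube Q → orliczNorm Ψ w Q ≤ c * cubeAvg Q w

/-- The generalized reverse Hölder class `RH_Ψ`. -/
def RHOrlicz {n : ℕ} (Ψ : ℝ → ℝ) (w : Rn n → ℝ) : Prop :=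
  ∃ c : ℝ, RHOrliczWith Ψ w c

/-- `w ∈ RH_s` with constant `c`. -/
def RHWith {n : ℕ} (s : ℝ) (w : Rn n → ℝ) (c : ℝ) : Prop :=
  ∀ Q : Set (Rn n), IsCube Q →
    (cubeAvg Q fun x => w x ^ s) ^ (1 / s) ≤ c * cubeAvg Q w

/-- `w ∈ RH_∞` with constant `c`: `ess sup_Q w ≤ c ⨍_Q w` for all cubes `Q`. -/
def RHInftyWith {n : ℕ} (w : Rn n → ℝ) (c : ℝ) : Prop :=
  ∀ Q : Set (Rn n), IsCube Q →
    essSup (fun x => ENNReal.ofReal (w x)) (volume.restrict Q)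
      ≤ ENNReal.ofReal (c * cubeAvg Q w)

/-- `w ∈ RH_{(q₀/p)'}` with constant `c`, with the convention that this means `RH_∞`
when `p = q₀`. -/
def RHConjWith {n : ℕ} (q₀ p : ℝ) (w : Rn n → ℝ) (c : ℝ) : Prop :=
  if p = q₀ then RHInftyWith w c else RHWith (conjExp (q₀ / p)) w c

/-- The Orlicz maximal operator `M_Ψ f(x) = sup_{Q ∋ x} ‖f‖_{Ψ,Q}` (`ℝ≥0∞`-valued). -/
def orliczMax {n : ℕ} (Ψ : ℝ → ℝ) (f : Rn n → ℝ) (x : Rn n) : ℝ≥0∞ :=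
  ⨆ (Q : Set (Rn n)) (_ : IsCube Q ∧ x ∈ Q), ENNReal.ofReal (orliczNorm Ψ f Q)



/-- Bounded and compactly supported. -/
def IsBddCS {n : ℕ} (f : Rn n → ℝ) : Prop :=
  (∃ M : ℝ, ∀ x, |f x| ≤ M) ∧ HasCompactSupport f

/-- A Calderón–Zygmund operator. -/
def IsCZO {n : ℕ} (T : (Rn n → ℝ) → Rn n → ℝ) : Prop :=
  (∀ f g : Rn n → ℝ, T (f + g) = T f + T g) ∧
  (∀ (c : ℝ) (f : Rn n → ℝ), T (c • f) = c • T f) ∧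
  (∃ C : ℝ, 0 < C ∧ ∀ f : Rn n → ℝ, MemLp f 2 volume →
      eLpNorm (T f) 2 volume ≤ ENNReal.ofReal C * eLpNorm f 2 volume) ∧
  ∃ (K : Rn n → Rn n → ℝ) (C₀ ε : ℝ), 0 < C₀ ∧ 0 < ε ∧
    (∀ x y : Rn n, x ≠ y → |K x y| ≤ C₀ * ‖x - y‖ ^ (-(n : ℝ))) ∧
    (∀ x y h : Rn n, 2 * ‖h‖ < ‖x - y‖ →
      |K x y - K x (y + h)| + |K x y - K (x + h) y|
        ≤ C₀ * ‖h‖ ^ ε * ‖x - y‖ ^ (-(n : ℝ) - ε)) ∧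
    ∀ f : Rn n → ℝ, IsBddCS f →
      ∀ᵐ x, x ∉ tsupport f → T f x = ∫ y, K x y * f y

/-- A bilinear Calderón–Zygmund operator. -/
def IsBilinearCZO {n : ℕ} (T : (Rn n → ℝ) → (Rn n → ℝ) → Rn n → ℝ) : Prop :=
  (∀ f₁ f₂ g : Rn n → ℝ, T (f₁ + f₂) g = T f₁ g + T f₂ g) ∧
  (∀ (f g₁ g₂ : Rn n → ℝ), T f (g₁ + g₂) = T f g₁ + T f g₂) ∧
  (∀ (c : ℝ) (f g : Rn n → ℝ), T (c • f) g = c • T f g) ∧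
  (∀ (c : ℝ) (f g : Rn n → ℝ), T f (c • g) = c • T f g) ∧
  (∃ C : ℝ, 0 < C ∧ ∀ f g : Rn n → ℝ, MemLp f 2 volume → MemLp g 2 volume →
      eLpNorm (T f g) 1 volume ≤ ENNReal.ofReal C * (eLpNorm f 2 volume * eLpNorm g 2 volume)) ∧
  ∃ (K : Rn n → Rn n → Rn n → ℝ) (C₀ : ℝ), 0 < C₀ ∧
    (∀ x y z : Rn n, ¬(y = x ∧ z = x) →
      |K x y z| ≤ C₀ * (‖x - y‖ + ‖x - z‖) ^ (-(2 * (n : ℝ)))) ∧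
    (∀ x y z : Rn n, ¬(y = x ∧ z = x) →
      ‖fderiv ℝ (fun q : Rn n × Rn n × Rn n => K q.1 q.2.1 q.2.2) (x, y, z)‖
        ≤ C₀ * (‖x - y‖ + ‖x - z‖) ^ (-(2 * (n : ℝ)) - 1)) ∧
    ∀ f g : Rn n → ℝ, IsBddCS f → IsBddCS g →
      ∀ᵐ x, x ∉ tsupport f ∩ tsupport g →
        T f g x = ∫ q : Rn n × Rn n, K x q.1 q.2 * f q.1 * g q.2

/-- The bisublinear Orlicz maximal operator. -/
def biOrliczMax {n : ℕ} (Ψ₁ Ψ₂ : ℝ → ℝ) (f g : Rn n → ℝ) (x : Rn n) : ℝ≥0∞ :=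
  ⨆ (Q : Set (Rn n)) (_ : IsCube Q ∧ x ∈ Q),
    ENNReal.ofReal (orliczNorm Ψ₁ f Q * orliczNorm Ψ₂ g Q)

/-- The bilinear fractional integral operator. -/
def BIalpha {n : ℕ} (α : ℝ) (f g : Rn n → ℝ) (x : Rn n) : ℝ≥0∞ :=
  ∫⁻ y, ENNReal.ofReal (f (x - y) * g (x + y) * ‖y‖ ^ (α - (n : ℝ)))

/-- The bisublinear fractional maximal operator `𝓜_α`. -/
def biFracMax {n : ℕ} (α : ℝ) (f g : Rn n → ℝ) (x : Rn n) : ℝ≥0∞ :=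
  ⨆ (Q : Set (Rn n)) (_ : IsCube Q ∧ x ∈ Q),
    ENNReal.ofReal ((volume Q).toReal ^ (α / (n : ℝ)) *
      cubeAvg Q (fun y => |f y|) * cubeAvg Q (fun z => |g z|))

/-- A dyadic grid, given by its generations `D k`. -/
def IsDyadicGrid {n : ℕ} (D : ℤ → Set (Set (Rn n))) : Prop :=
  (∀ k : ℤ, ∀ Q ∈ D k, ∃ c : Rn n,
      Q = Set.univ.pi fun i => Set.Ico (c i) (c i + (2 : ℝ) ^ (-k))) ∧
  (∀ k : ℤ, ⋃₀ D k = Set.univ) ∧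
  (∀ k : ℤ, (D k).PairwiseDisjoint id) ∧
  (∀ P Q : Set (Rn n), (∃ k, P ∈ D k) → (∃ k, Q ∈ D k) →
    P ∩ Q = ∅ ∨ P ⊆ Q ∨ Q ⊆ P)

/-- A sparse family of cubes. -/
def IsSparse {n : ℕ} (S : Set (Set (Rn n))) : Prop :=
  ∀ Q ∈ S, volume (⋃ Q' ∈ {Q' | Q' ∈ S ∧ Q' ⊂ Q}, Q') ≤ volume Q / 2

/-- The sparse operator `T^𝒮 f = Σ_{Q ∈ 𝒮} (⨍_Q f) χ_Q`. -/
def sparseOp {n : ℕ} (S : Set (Set (Rn n))) (f : Rn n → ℝ) (x : Rn n) : ℝ≥0∞ :=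
  ∑' Q : S, Set.indicator (Q : Set (Rn n)) (fun _ => ENNReal.ofReal (cubeAvg (Q : Set (Rn n)) f)) x

/-- The bilinear sparse operator. -/
def sparseOp2 {n : ℕ} (S : Set (Set (Rn n))) (f g : Rn n → ℝ) (x : Rn n) : ℝ≥0∞ :=
  ∑' Q : S, Set.indicator (Q : Set (Rn n))
    (fun _ => ENNReal.ofReal (cubeAvg (Q : Set (Rn n)) f * cubeAvg (Q : Set (Rn n)) g)) x

/-- `w ∈ A_p` with constant `c`. -/
def ApWith {n : ℕ} (p : ℝ) (w : Rn n → ℝ) (c : ℝ) : Prop :=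
  ∀ Q : Set (Rn n), IsCube Q →
    cubeAvg Q w * (cubeAvg Q fun x => w x ^ (1 - conjExp p)) ^ (p - 1) ≤ c

/-- `H ∈ A₁` with constant `c`: `⨍_Q H ≤ c H(x)` for a.e. `x ∈ Q`. -/
def A1With {n : ℕ} (H : Rn n → ℝ) (c : ℝ) : Prop :=
  ∀ Q : Set (Rn n), IsCube Q →
    ∀ᵐ x ∂(volume.restrict Q), cubeAvg Q H ≤ c * H x

/-- Real-valued Orlicz maximal operator. -/
def orliczMaxR {n : ℕ} (Ψ : ℝ → ℝ) (f : Rn n → ℝ) (x : Rn n) : ℝ :=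
  sSup {r : ℝ | ∃ Q : Set (Rn n), IsCube Q ∧ x ∈ Q ∧ r = orliczNorm Ψ f Q}

/-- Iterates of the Orlicz maximal operator. -/
def iterM {n : ℕ} (Ψ : ℝ → ℝ) (h : Rn n → ℝ) : ℕ → Rn n → ℝ
  | 0 => h
  | k + 1 => orliczMaxR Ψ (iterM Ψ h k)

/-- The Rubio de Francia iteration `𝓡h = Σ_k M^k h / (2^k ‖M‖^k)`. -/
def RdF {n : ℕ} (Ψ : ℝ → ℝ) (Mnorm : ℝ) (h : Rn n → ℝ) (x : Rn n) : ℝ :=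
  ∑' k : ℕ, iterM Ψ h k x / (2 ^ k * Mnorm ^ k)


lemma IsCube.exists_closedBall {n : ℕ} {Q : Set (Rn n)} (h : IsCube Q) :
    ∃ (c : Rn n) (r : ℝ), 0 < r ∧ Q = Metric.closedBall c r := by
  obtain ⟨c, h, hh, rfl⟩ := h
  refine ⟨fun i => c i + h / 2, h / 2, by positivity, ?_⟩
  rw [closedBall_pi _ (by positivity)]
  congr 1
  funext i
  rw [Real.closedBall_eq_Icc]
  congr 1 <;> ring

lemma isCube_closedBall {n : ℕ} (c : Rn n) {r : ℝ} (hr : 0 < r) :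
    IsCube (Metric.closedBall c r) := by
  refine ⟨fun i => c i - r, 2 * r, by positivity, ?_⟩
  rw [closedBall_pi _ hr.le]
  congr 1
  funext i
  rw [Real.closedBall_eq_Icc]
  congr 1; ring

lemma weak_cover {n : ℕ} (hn : 1 ≤ n) (g : Rn n → ℝ≥0∞) (E : Set (Rn n))
    (hE : ∀ x ∈ E, ∃ (c : Rn n) (r : ℝ), 0 < r ∧ x ∈ Metric.closedBall c r ∧
      volume (Metric.closedBall c r) ≤ 2 * ∫⁻ y in Metric.closedBall c r, g y) :
    volume E ≤ 2 * 5 ^ n * ∫⁻ y, g y := by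
  by_cases hg : ∫⁻ y, g y = ⊤
  · rw [hg, ENNReal.mul_top (by positivity)]; exact le_top
  choose! c r hr hx hv using hE
  set I := (∫⁻ y, g y).toReal with hI
  have hbd : ∀ a ∈ E, r a ≤ 2 * I + 1 := by
    intro a ha
    have h1 : volume (Metric.closedBall (c a) (r a)) ≤ 2 * ∫⁻ y, g y :=
      (hv a ha).trans (by gcongr; exact Measure.restrict_le_self)
    rw [Real.volume_pi_closedBall _ (hr a ha).le, ← ENNReal.ofReal_toReal hg,
      show (2 : ℝ≥0∞) = ENNReal.ofReal 2 by simp, ← ENNReal.ofReal_mul (by norm_num),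
      ENNReal.ofReal_le_ofReal_iff (by positivity)] at h1
    simp only [Fintype.card_fin] at h1
    have hI0 : 0 ≤ I := ENNReal.toReal_nonneg
    by_contra! hcon
    have h2 : 1 ≤ 2 * r a := by linarith
    have := le_self_pow₀ h2 (by omega : n ≠ 0)
    linarith
  obtain ⟨u, hut, hdisj, hcov⟩ :=
    Vitali.exists_disjoint_subfamily_covering_enlargement_closedBall E c r (2 * I + 1) hbd 5
      (by norm_num)
  have hcount : u.Countable := hdisj.countable_of_nonempty_interior (fun i hi =>
    ⟨c i, Metric.ball_subset_interior_closedBall (Metric.mem_ball_self (hr i (hut hi)))⟩)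
  have hsub : E ⊆ ⋃ b ∈ u, Metric.closedBall (c b) (5 * r b) := by
    intro x hxE
    obtain ⟨b, hb, hb'⟩ := hcov x hxE
    exact Set.mem_biUnion hb (hb' (hx x hxE))
  calc volume E ≤ volume (⋃ b ∈ u, Metric.closedBall (c b) (5 * r b)) := measure_mono hsub
    _ ≤ ∑' b : u, volume (Metric.closedBall (c b) (5 * r b)) := measure_biUnion_le _ hcount _
    _ ≤ ∑' b : u, 2 * 5 ^ n * ∫⁻ y in Metric.closedBall (c b) (r b), g y := by
        refine ENNReal.tsum_le_tsum (fun b => ?_)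
        have hb := hr b (hut b.2)
        have h5 : volume (Metric.closedBall (c b) (5 * r b))
            = 5 ^ n * volume (Metric.closedBall (c b) (r b)) := by
          rw [Real.volume_pi_closedBall _ (by positivity), Real.volume_pi_closedBall _ hb.le,
            show (5 : ℝ≥0∞) = ENNReal.ofReal 5 by simp, ← ENNReal.ofReal_pow (by norm_num),
            ← ENNReal.ofReal_mul (by positivity)]
          congr 1
          simp only [Fintype.card_fin]
          rw [← mul_pow]; congr 1; ring
        rw [h5, mul_comm 2, mul_assoc]
        gcongr
        exact hv b (hut b.2)
    _ = 2 * 5 ^ n * ∫⁻ y in ⋃ b ∈ u, Metric.closedBall (c b) (r b), g y := by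
        rw [ENNReal.tsum_mul_left, lintegral_biUnion hcount
          (fun i _ => Metric.isClosed_closedBall.measurableSet) hdisj]
    _ ≤ 2 * 5 ^ n * ∫⁻ y, g y := by gcongr; exact Measure.restrict_le_self

lemma IsYoung.nonneg {Ψ : ℝ → ℝ} (h : IsYoung Ψ) {t : ℝ} (ht : 0 ≤ t) : 0 ≤ Ψ t := by
  rw [← h.2.2.2.1]
  exact h.2.1.monotoneOn Set.self_mem_Ici ht ht

lemma IsYoung.mono {Ψ : ℝ → ℝ} (h : IsYoung Ψ) {s t : ℝ} (hs : 0 ≤ s) (ht : s ≤ t) :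
    Ψ s ≤ Ψ t :=
  h.2.1.monotoneOn hs (hs.trans ht : (0:ℝ) ≤ t) ht

lemma IsYoung.le_mul {Ψ : ℝ → ℝ} (h : IsYoung Ψ) {s : ℝ} (hs : 0 ≤ s) (hs1 : s ≤ 1) :
    Ψ s ≤ s * Ψ 1 := by
  have := h.1.2 (x := 1) (y := 0) (by simp) (by simp) hs (sub_nonneg.2 hs1) (by ring)
  simpa [h.2.2.2.1] using this

lemma IsYoung.exists_half {Ψ : ℝ → ℝ} (h : IsYoung Ψ) : ∃ a, 0 < a ∧ a ≤ 1 ∧ Ψ a ≤ 1 / 2 := by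
  have h1 := h.nonneg (zero_le_one)
  refine ⟨1 / (2 * (Ψ 1 + 1)), by positivity, ?_, ?_⟩
  · rw [div_le_one (by positivity)]; linarith
  · refine (h.le_mul (by positivity) ?_).trans ?_
    · rw [div_le_one (by positivity)]; linarith
    · rw [div_mul_eq_mul_div, div_le_div_iff₀ (by positivity) (by positivity)]; linarith

lemma IsYoung.continuous_max {Ψ : ℝ → ℝ} (h : IsYoung Ψ) : Continuous (fun t => Ψ (max t 0)) :=
  h.2.2.1.comp_continuous (by fun_prop) (fun x => Set.mem_Ici.2 (le_max_right _ _))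

lemma level_bound {n : ℕ} {Ψ : ℝ → ℝ} (hΨ : IsYoung Ψ) (f : Rn n → ℝ) {a lam : ℝ}
    (hlam : 0 < lam) (ha2 : Ψ a ≤ 1 / 2)
    (c : Rn n) {r : ℝ} (hr : 0 < r) (hQ : lam < orliczNorm Ψ f (Metric.closedBall c r)) :
    volume (Metric.closedBall c r) ≤ 2 * ∫⁻ y in Metric.closedBall c r,
      ENNReal.ofReal (if a * lam < |f y| then Ψ (|f y| / lam) else 0) := by
  set Q := Metric.closedBall c r with hQdef
  have hnot := notMem_of_lt_csInf hQ ⟨0, fun x hx => hx.1.le⟩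
  have h1 : 1 < cubeAvg Q (fun x => Ψ (|f x| / lam)) := by
    by_contra! hcon; exact hnot ⟨hlam, hcon⟩
  have hVtop : volume Q ≠ ⊤ := measure_closedBall_lt_top.ne
  have hV0 : volume Q ≠ 0 := (Metric.measure_closedBall_pos _ _ hr).ne'
  have hV : 0 < (volume Q).toReal := ENNReal.toReal_pos hV0 hVtop
  unfold cubeAvg at h1
  rw [inv_mul_eq_div, one_lt_div hV] at h1
  have hint : Integrable (fun x => Ψ (|f x| / lam)) (volume.restrict Q) := by
    by_contra hcon
    rw [integral_undef hcon] at h1; linarith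
  have h2 : volume Q ≤ ∫⁻ y in Q, ENNReal.ofReal (Ψ (|f y| / lam)) := by
    rw [← ofReal_integral_eq_lintegral_ofReal hint
      (Eventually.of_forall fun x => hΨ.nonneg (by positivity)), ← ENNReal.ofReal_toReal hVtop]
    exact ENNReal.ofReal_le_ofReal h1.le
  have h3 : ∫⁻ y in Q, ENNReal.ofReal (Ψ (|f y| / lam)) ≤ 2⁻¹ * volume Q + ∫⁻ y in Q,
      ENNReal.ofReal (if a * lam < |f y| then Ψ (|f y| / lam) else 0) := by
    rw [← setLIntegral_const, ← lintegral_add_left measurable_const]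
    refine lintegral_mono (fun y => ?_)
    dsimp only
    split_ifs with hy
    · exact le_add_self
    · rw [ENNReal.ofReal_zero, add_zero]
      have : Ψ (|f y| / lam) ≤ 1 / 2 := by
        refine (hΨ.mono (by positivity) ?_).trans ha2
        rw [div_le_iff₀ hlam]; exact not_lt.1 hy
      refine (ENNReal.ofReal_le_ofReal this).trans ?_
      rw [one_div, ENNReal.ofReal_inv_of_pos (by norm_num)]; simp
  have h4 := h2.trans h3
  set J := ∫⁻ y in Q, ENNReal.ofReal (if a * lam < |f y| then Ψ (|f y| / lam) else 0)
  have h5 : 2⁻¹ * volume Q + 2⁻¹ * volume Q ≤ 2⁻¹ * volume Q + J := by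
    rw [← add_mul, ENNReal.inv_two_add_inv_two, one_mul]; exact h4
  have h6 := (ENNReal.add_le_add_iff_left (ENNReal.mul_ne_top (by simp) hVtop)).1 h5
  calc volume Q = 2 * (2⁻¹ * volume Q) := by
        rw [← mul_assoc, ENNReal.mul_inv_cancel (by simp) (by simp), one_mul]
    _ ≤ 2 * J := by gcongr

lemma sum_bound {Ψ : ℝ → ℝ} (hΨ : IsYoung Ψ) {p : ℝ} (hp : 1 < p) {a : ℝ} (ha : 0 < a)
    {y : ℝ} (hy : 0 ≤ y) :
    ∑' k : ℤ, ENNReal.ofReal (((2:ℝ) ^ (k + 1)) ^ p) *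
      ENNReal.ofReal (if a * (2:ℝ) ^ k < y then Ψ (y / (2:ℝ) ^ k) else 0) ≤
    ENNReal.ofReal (2 ^ p * 2 ^ (p + 1)) *
      (∫⁻ t in Set.Ioi a, ENNReal.ofReal (Ψ t / t ^ p / t)) * ENNReal.ofReal (y ^ p) := by
  set F : ℝ → ℝ≥0∞ := fun t => ENNReal.ofReal (Ψ t / t ^ p / t) with hF
  set S : ℤ → Set ℝ := fun k => Set.Ioi a ∩ Set.Ioc (y / 2 ^ k) (2 * y / 2 ^ k) with hS
  have hterm : ∀ k : ℤ, ENNReal.ofReal (((2:ℝ) ^ (k + 1)) ^ p) *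
      ENNReal.ofReal (if a * (2:ℝ) ^ k < y then Ψ (y / (2:ℝ) ^ k) else 0) ≤
      ENNReal.ofReal (2 ^ p * 2 ^ (p + 1)) * ENNReal.ofReal (y ^ p) * ∫⁻ t in S k, F t := by
    intro k
    split_ifs with hk
    swap
    · simp
    have h2k : (0:ℝ) < 2 ^ k := by positivity
    set u := y / (2:ℝ) ^ k with hu
    have hau : a < u := by rw [hu, lt_div_iff₀ h2k]; exact hk
    have hu0 : 0 < u := ha.trans hau
    have hyu : y = u * 2 ^ k := by rw [hu]; field_simp
    have hSk : S k = Set.Ioc u (2 * u) := by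
      have : 2 * y / (2:ℝ) ^ k = 2 * u := by rw [hu]; ring
      simp only [hS, this]
      rw [Set.inter_eq_right]
      exact fun t ht => hau.trans ht.1
    have hlow : ENNReal.ofReal (Ψ u / (2 * u) ^ p / (2 * u)) * ENNReal.ofReal u
        ≤ ∫⁻ t in S k, F t := by
      rw [hSk]
      have : ENNReal.ofReal u = volume (Set.Ioc u (2 * u)) := by
        rw [Real.volume_Ioc]; congr 1; ring
      rw [this, ← setLIntegral_const]
      refine setLIntegral_mono' measurableSet_Ioc (fun t ht => ENNReal.ofReal_le_ofReal ?_)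
      have ht0 : 0 < t := hu0.trans ht.1
      have := hΨ.mono hu0.le ht.1.le
      have h0 := hΨ.nonneg hu0.le
      have h0' := hΨ.nonneg ht0.le
      have htp : t ^ p ≤ (2 * u) ^ p := Real.rpow_le_rpow ht0.le ht.2 (by linarith)
      have htp0 : 0 < t ^ p := Real.rpow_pos_of_pos ht0 _
      exact div_le_div₀ (by positivity) (div_le_div₀ h0' this htp0 htp) ht0 ht.2
    refine le_trans ?_ (mul_le_mul_right hlow _)
    have h0 := hΨ.nonneg hu0.le
    rw [← ENNReal.ofReal_mul (by positivity), ← ENNReal.ofReal_mul (by positivity),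
      ← ENNReal.ofReal_mul (by positivity), ← ENNReal.ofReal_mul (by positivity)]
    apply ENNReal.ofReal_le_ofReal
    apply le_of_eq
    rw [hyu, zpow_add₀ (by norm_num), Real.mul_rpow hu0.le h2k.le, Real.mul_rpow h2k.le (by norm_num),
      Real.mul_rpow (by norm_num) hu0.le, zpow_one, Real.rpow_add_one (by norm_num)]
    have := Real.rpow_pos_of_pos hu0 p
    have := Real.rpow_pos_of_pos (two_pos : (0:ℝ) < 2) p
    field_simp
  have hdisj : Pairwise (Function.onFun Disjoint S) := by
    have hanti : Antitone (fun k : ℤ => 2 * y / (2:ℝ) ^ k) := by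
      intro i j hij
      dsimp only
      have : (2:ℝ) ^ i ≤ 2 ^ j := zpow_le_zpow_right₀ (by norm_num) hij
      exact div_le_div_of_nonneg_left (by positivity) (by positivity) this
    have h := hanti.pairwise_disjoint_on_Ioc_succ
    intro i j hij
    have h' := h hij
    have key : ∀ i : ℤ, S i ⊆ Set.Ioc (2 * y / (2:ℝ) ^ (Order.succ i)) (2 * y / 2 ^ i) := by
      intro i t ht
      refine ⟨?_, ht.2.2⟩
      have : 2 * y / (2:ℝ) ^ (Order.succ i) = y / 2 ^ i := by
        rw [Int.succ_eq_succ, Int.succ, zpow_add₀ (by norm_num)]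
        field_simp
      rw [this]; exact ht.2.1
    exact Disjoint.mono (key i) (key j) h'
  calc _ ≤ ∑' k : ℤ, ENNReal.ofReal (2 ^ p * 2 ^ (p + 1)) * ENNReal.ofReal (y ^ p) *
        ∫⁻ t in S k, F t := ENNReal.tsum_le_tsum hterm
    _ = ENNReal.ofReal (2 ^ p * 2 ^ (p + 1)) * ENNReal.ofReal (y ^ p) *
        ∫⁻ t in ⋃ k, S k, F t := by
        rw [ENNReal.tsum_mul_left, lintegral_iUnion
          (fun i => measurableSet_Ioi.inter measurableSet_Ioc) hdisj]
    _ ≤ ENNReal.ofReal (2 ^ p * 2 ^ (p + 1)) * ENNReal.ofReal (y ^ p) *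
        ∫⁻ t in Set.Ioi a, F t := by
        gcongr
        exact Set.iUnion_subset fun k => Set.inter_subset_left
    _ = _ := by ring

lemma tail_finite {Ψ : ℝ → ℝ} (hΨ : IsYoung Ψ) {p : ℝ} {a b : ℝ} (ha : 0 < a)
    (hab : a ≤ b) (hB : ∫⁻ t in Set.Ioi b, ENNReal.ofReal (Ψ t / t ^ p / t) < ⊤) :
    ∫⁻ t in Set.Ioi a, ENNReal.ofReal (Ψ t / t ^ p / t) < ⊤ := by
  rw [← Set.Ioc_union_Ioi_eq_Ioi hab]
  refine (lintegral_union_le _ _ _).trans_lt (ENNReal.add_lt_top.2 ⟨?_, hB⟩)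
  have hcont : ContinuousOn (fun t => Ψ t / t ^ p / t) (Set.Icc a b) := by
    refine ContinuousOn.div (ContinuousOn.div (hΨ.2.2.1.mono ?_) ?_ ?_) continuousOn_id ?_
    · exact fun t ht => ha.le.trans ht.1
    · exact ContinuousOn.rpow_const continuousOn_id (fun t ht => Or.inl (ha.trans_le ht.1).ne')
    · exact fun t ht => (Real.rpow_pos_of_pos (ha.trans_le ht.1) _).ne'
    · exact fun t ht => (ha.trans_le ht.1).ne'
  have := (hcont.integrableOn_Icc (μ := volume)).mono_set Set.Ioc_subset_Icc_self
  have h2 := this.2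
  refine lt_of_le_of_lt ?_ h2
  refine lintegral_mono fun t => ?_
  rw [← ofReal_norm_eq_enorm]
  exact ENNReal.ofReal_le_ofReal (Real.le_norm_self _)

lemma upper {n : ℕ} (hn : 1 ≤ n) {p : ℝ} (hp : 1 < p) {Ψ : ℝ → ℝ} (hΨ : IsYoung Ψ)
    (hB : BClass p Ψ) : ∃ K : ℝ≥0∞, K ≠ ⊤ ∧ ∀ f : Rn n → ℝ, AEMeasurable f volume →
      ∫⁻ x, orliczMax Ψ f x ^ p ≤ K * ∫⁻ x, ENNReal.ofReal (|f x| ^ p) := by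
  obtain ⟨a, ha, ha1, ha2⟩ := hΨ.exists_half
  have hfin := tail_finite hΨ ha ha1 hB
  refine ⟨2 * 5 ^ n * (ENNReal.ofReal (2 ^ p * 2 ^ (p + 1)) *
      (∫⁻ t in Set.Ioi a, ENNReal.ofReal (Ψ t / t ^ p / t))), ?_, ?_⟩
  · exact ENNReal.mul_ne_top (ENNReal.mul_ne_top (by simp) (by finiteness))
      (ENNReal.mul_ne_top ENNReal.ofReal_ne_top hfin.ne)
  intro f hf
  set g : ℤ → Rn n → ℝ≥0∞ := fun k y =>
    ENNReal.ofReal (if a * (2:ℝ) ^ k < |f y| then Ψ (|f y| / (2:ℝ) ^ k) else 0) with hg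
  have hgm : ∀ k, AEMeasurable (g k) volume := by
    intro k
    have h1 : Measurable (fun s : ℝ => ENNReal.ofReal
        (if a * (2:ℝ) ^ k < |s| then Ψ (max (|s| / (2:ℝ) ^ k) 0) else 0)) := by
      refine ENNReal.measurable_ofReal.comp (Measurable.ite ?_ ?_ measurable_const)
      · exact measurableSet_lt measurable_const (by fun_prop)
      · exact hΨ.continuous_max.measurable.comp (by fun_prop)
    refine (h1.comp_aemeasurable hf).congr (Eventually.of_forall fun y => ?_)
    have : max (|f y| / (2:ℝ) ^ k) 0 = |f y| / (2:ℝ) ^ k := max_eq_left (by positivity)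
    simp only [Function.comp, hg, this]
  set E : ℤ → Set (Rn n) := fun k => {x | ENNReal.ofReal ((2:ℝ) ^ k) < orliczMax Ψ f x} with hEdef
  have hE : ∀ k, volume (E k) ≤ 2 * 5 ^ n * ∫⁻ y, g k y := by
    intro k
    refine weak_cover hn _ _ (fun x hx => ?_)
    simp only [hEdef, Set.mem_setOf_eq, orliczMax, lt_iSup_iff] at hx
    obtain ⟨Q, ⟨hQ, hxQ⟩, hlt⟩ := hx
    obtain ⟨c, r, hr, rfl⟩ := hQ.exists_closedBall
    refine ⟨c, r, hr, hxQ, level_bound hΨ f (by positivity) ha2 c hr ?_⟩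
    exact (ENNReal.ofReal_lt_ofReal_iff_of_nonneg (by positivity)).1 hlt
  have hpt : ∀ x, orliczMax Ψ f x ^ p ≤ ∑' k : ℤ, ENNReal.ofReal (((2:ℝ) ^ (k + 1)) ^ p) *
      (toMeasurable volume (E k)).indicator 1 x := by
    intro x
    rw [← ENNReal.le_rpow_inv_iff (by linarith)]
    rw [orliczMax]
    refine iSup₂_le (fun Q hQ => ?_)
    rw [ENNReal.le_rpow_inv_iff (by linarith)]
    rcases le_or_gt (orliczNorm Ψ f Q) 0 with h0 | h0
    · rw [ENNReal.ofReal_of_nonpos h0, ENNReal.zero_rpow_of_pos (by linarith)]; exact zero_le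
    obtain ⟨k, hk⟩ := exists_mem_Ioc_zpow h0 (one_lt_two : (1:ℝ) < 2)
    refine le_trans ?_ (ENNReal.le_tsum k)
    have hxE : x ∈ toMeasurable volume (E k) := by
      apply subset_toMeasurable
      refine lt_of_lt_of_le ((ENNReal.ofReal_lt_ofReal_iff_of_nonneg (by positivity)).2 hk.1) ?_
      exact le_iSup₂ (f := fun Q _ => ENNReal.ofReal (orliczNorm Ψ f Q)) Q hQ
    rw [Set.indicator_of_mem hxE, Pi.one_apply, mul_one, ENNReal.ofReal_rpow_of_pos h0]
    exact ENNReal.ofReal_le_ofReal (Real.rpow_le_rpow h0.le hk.2 (by linarith))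
  calc ∫⁻ x, orliczMax Ψ f x ^ p ≤ ∫⁻ x, ∑' k : ℤ, ENNReal.ofReal (((2:ℝ) ^ (k + 1)) ^ p) *
      (toMeasurable volume (E k)).indicator 1 x := lintegral_mono hpt
    _ = ∑' k : ℤ, ENNReal.ofReal (((2:ℝ) ^ (k + 1)) ^ p) * volume (E k) := by
        rw [lintegral_tsum]
        · congr 1
          funext k
          rw [lintegral_const_mul _ (measurable_one.indicator (measurableSet_toMeasurable _ _)),
            lintegral_indicator_one (measurableSet_toMeasurable _ _), measure_toMeasurable]
        · intro k
          exact ((measurable_one.indicator (measurableSet_toMeasurable _ _)).const_mul _).aemeasurable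
    _ ≤ ∑' k : ℤ, 2 * 5 ^ n * ∫⁻ y, ENNReal.ofReal (((2:ℝ) ^ (k + 1)) ^ p) * g k y := by
        refine ENNReal.tsum_le_tsum fun k => ?_
        rw [lintegral_const_mul'' _ (hgm k), ← mul_assoc, mul_comm (2 * 5 ^ n), mul_assoc]
        gcongr
        exact hE k
    _ = 2 * 5 ^ n * ∫⁻ y, ∑' k : ℤ, ENNReal.ofReal (((2:ℝ) ^ (k + 1)) ^ p) * g k y := by
        rw [ENNReal.tsum_mul_left, lintegral_tsum (fun k => (hgm k).const_mul _)]
    _ ≤ 2 * 5 ^ n * ∫⁻ y, ENNReal.ofReal (2 ^ p * 2 ^ (p + 1)) *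
      (∫⁻ t in Set.Ioi a, ENNReal.ofReal (Ψ t / t ^ p / t)) * ENNReal.ofReal (|f y| ^ p) := by
        gcongr with y
        exact sum_bound hΨ hp ha (abs_nonneg (f y))
    _ = _ := by
        rw [lintegral_const_mul' _ _ (ENNReal.mul_ne_top ENNReal.ofReal_ne_top hfin.ne), mul_assoc (2 * 5 ^ n)]

/-- Lower bound for the maximal function of the indicator of the unit ball. -/
lemma max_lower {n : ℕ} {Ψ : ℝ → ℝ} (hΨ : IsYoung Ψ) {t : ℝ} (ht : 0 < t)
    (ht1 : 1 < Ψ t) (x : Rn n) (hx : ‖x‖ ^ n < Ψ t) :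
    ENNReal.ofReal (1 / t) ≤
      orliczMax Ψ ((Metric.closedBall (0 : Rn n) 1).indicator (fun _ => (1:ℝ))) x := by
  set f : Rn n → ℝ := (Metric.closedBall (0 : Rn n) 1).indicator (fun _ => (1:ℝ)) with hf
  set R := max 1 ‖x‖ with hR
  have hR1 : 1 ≤ R := le_max_left _ _
  have hR0 : 0 < R := by linarith
  have hRn : R ^ n < Ψ t := by
    rcases max_cases 1 ‖x‖ with h | h
    · rw [hR, h.1, one_pow]; exact ht1
    · rw [hR, h.1]; exact hx
  set Q := Metric.closedBall (0 : Rn n) R with hQ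
  have havg : ∀ lam : ℝ, cubeAvg Q (fun y => Ψ (|f y| / lam)) = Ψ (1 / lam) / R ^ n := by
    intro lam
    have h1 : (fun y => Ψ (|f y| / lam)) =
        (Metric.closedBall (0 : Rn n) 1).indicator (fun _ => Ψ (1 / lam)) := by
      funext y
      by_cases hy : y ∈ Metric.closedBall (0 : Rn n) 1
      · simp [hf, hy]
      · simp only [hf, Set.indicator_of_notMem hy]; simp [hΨ.2.2.2.1]
    have h2 : Metric.closedBall (0 : Rn n) 1 ⊆ Q := Metric.closedBall_subset_closedBall hR1
    rw [cubeAvg, h1, setIntegral_indicator Metric.isClosed_closedBall.measurableSet,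
      Set.inter_eq_right.2 h2, setIntegral_const, hQ, Real.volume_pi_closedBall _ hR0.le,
      measureReal_def,
      Real.volume_pi_closedBall _ zero_le_one, ENNReal.toReal_ofReal (by positivity),
      ENNReal.toReal_ofReal (by positivity)]
    simp only [Fintype.card_fin, smul_eq_mul, mul_pow, mul_one, one_pow]
    field_simp
  have hnorm : 1 / t ≤ orliczNorm Ψ f Q := by
    rw [orliczNorm]
    refine le_csInf ?_ ?_
    · have h1 := hΨ.nonneg zero_le_one
      have hRn1 : 1 ≤ R ^ n := one_le_pow₀ hR1
      refine ⟨Ψ 1 + 1, by positivity, ?_⟩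
      rw [havg, div_le_one (by positivity)]
      refine (hΨ.le_mul (by positivity) ?_).trans ?_
      · rw [div_le_one (by positivity)]; linarith
      · refine le_trans ?_ hRn1
        rw [div_mul_eq_mul_div, div_le_one (by positivity)]; linarith
    · rintro lam ⟨hl, hle⟩
      rw [havg, div_le_one (by positivity)] at hle
      by_contra! hcon
      have : t ≤ 1 / lam := by
        rw [le_div_iff₀ hl]
        rw [lt_div_iff₀ ht] at hcon
        linarith
      have := hΨ.mono ht.le this
      linarith
  refine (ENNReal.ofReal_le_ofReal hnorm).trans ?_
  exact le_iSup₂ (f := fun Q _ => ENNReal.ofReal (orliczNorm Ψ f Q)) Q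
    ⟨isCube_closedBall 0 hR0, by simp [hQ, hR]⟩

lemma tail_pow {p : ℝ} (hp : 1 < p) (M : ℝ≥0∞) {A : Set ℝ} (hA : MeasurableSet A)
    (hpos : ∀ t ∈ A, 0 < t)
    (h : ∀ t ∈ A, ENNReal.ofReal (1 / t) ≤ M) :
    ∫⁻ t in A, ENNReal.ofReal (t ^ (-p - 1)) ≤ M ^ p := by
  rcases eq_or_ne M ⊤ with rfl | hM
  · rw [ENNReal.top_rpow_of_pos (by linarith)]; exact le_top
  rcases A.eq_empty_or_nonempty with rfl | ⟨t0, ht0⟩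
  · simp
  have hm0 : 0 < M.toReal := by
    refine ENNReal.toReal_pos ?_ hM
    have := h t0 ht0
    have h2 : 0 < ENNReal.ofReal (1 / t0) := by
      have := hpos t0 ht0
      rw [ENNReal.ofReal_pos]; positivity
    exact (h2.trans_le this).ne'
  set m := M.toReal with hm
  have hsub : A ⊆ Set.Ici (1 / m) := by
    intro t ht
    have h1 := h t ht
    have h0 := hpos t ht
    rw [ENNReal.ofReal_le_iff_le_toReal hM, div_le_iff₀ h0] at h1
    rw [Set.mem_Ici, div_le_iff₀ hm0]; linarith
  have hc : 0 < 1 / m := by positivity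
  calc ∫⁻ t in A, ENNReal.ofReal (t ^ (-p - 1))
      ≤ ∫⁻ t in Set.Ici (1 / m), ENNReal.ofReal (t ^ (-p - 1)) := lintegral_mono_set hsub
    _ = ∫⁻ t in Set.Ioi (1 / m), ENNReal.ofReal (t ^ (-p - 1)) :=
        setLIntegral_congr Ioi_ae_eq_Ici.symm
    _ = ENNReal.ofReal (∫ t in Set.Ioi (1 / m), t ^ (-p - 1)) := by
        rw [ofReal_integral_eq_lintegral_ofReal (integrableOn_Ioi_rpow_of_lt (by linarith) hc)]
        refine (ae_restrict_iff' measurableSet_Ioi).2 (Eventually.of_forall fun t ht => ?_)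
        exact Real.rpow_nonneg (hc.le.trans (le_of_lt ht)) _
    _ ≤ ENNReal.ofReal (m ^ p) := by
        apply ENNReal.ofReal_le_ofReal
        rw [integral_Ioi_rpow_of_lt (by linarith) hc]
        have e1 : -p - 1 + 1 = -p := by ring
        rw [e1, neg_div_neg_eq, one_div, Real.inv_rpow hm0.le, Real.rpow_neg hm0.le, inv_inv]
        exact div_le_self (by positivity) hp.le
    _ = M ^ p := by
        rw [← ENNReal.ofReal_rpow_of_pos hm0, hm, ENNReal.ofReal_toReal hM]

lemma lower {n : ℕ} (hn : 1 ≤ n) {p : ℝ} (hp : 1 < p) {Ψ : ℝ → ℝ} (hΨ : IsYoung Ψ)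
    (hfin : ∫⁻ x, orliczMax Ψ ((Metric.closedBall (0 : Rn n) 1).indicator
      (fun _ => (1:ℝ))) x ^ p < ⊤) : BClass p Ψ := by
  set f : Rn n → ℝ := (Metric.closedBall (0 : Rn n) 1).indicator (fun _ => (1:ℝ)) with hf
  obtain ⟨T, hT1, hT⟩ : ∃ T : ℝ, 1 ≤ T ∧ ∀ t, T < t → 1 < Ψ t := by
    obtain ⟨T, hT⟩ := eventually_atTop.1 (hΨ.2.2.2.2.eventually_gt_atTop 1)
    refine ⟨max 1 T, le_max_left _ _, fun t ht => ?_⟩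
    have h1 : 1 < t := (le_max_left _ _).trans_lt ht
    have := hT t ((le_max_right _ _).trans ht.le)
    rw [lt_div_iff₀ (by linarith)] at this
    linarith
  refine tail_finite hΨ one_pos hT1 ?_
  refine lt_of_le_of_lt ?_ hfin
  set A : Rn n → Set ℝ := fun x => {t | T < t ∧ ‖x‖ ^ n < Ψ (max t 0)} with hA
  have hAm : ∀ x, MeasurableSet (A x) := fun x =>
    measurableSet_Ioi.inter (measurableSet_lt measurable_const hΨ.continuous_max.measurable)
  set B : Set (Rn n × ℝ) := {q | T < q.2 ∧ ‖q.1‖ ^ n < Ψ (max q.2 0)} with hB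
  have hBm : MeasurableSet B :=
    (measurableSet_lt measurable_const measurable_snd).inter
      (measurableSet_lt (by fun_prop) (hΨ.continuous_max.measurable.comp measurable_snd))
  set G : Rn n → ℝ → ℝ≥0∞ := fun x t => B.indicator (fun q => ENNReal.ofReal (q.2 ^ (-p - 1))) (x, t)
    with hG
  have hGm : Measurable (Function.uncurry G) := by
    have : Measurable (B.indicator (fun q => ENNReal.ofReal (q.2 ^ (-p - 1)))) :=
      Measurable.indicator (by fun_prop) hBm
    exact this
  calc ∫⁻ t in Set.Ioi T, ENNReal.ofReal (Ψ t / t ^ p / t)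
      ≤ ∫⁻ t in Set.Ioi T, ∫⁻ x, G x t := by
        refine setLIntegral_mono' measurableSet_Ioi (fun t ht => ?_)
        have ht0 : 0 < t := by have : T < t := ht; linarith
        have hΨt := hT t ht
        set ρ := Ψ t ^ ((n:ℝ)⁻¹) with hρ
        have hρ0 : 0 < ρ := Real.rpow_pos_of_pos (by linarith) _
        have hρn : ρ ^ n = Ψ t := Real.rpow_inv_natCast_pow (by linarith) (by omega)
        have hGt : ∀ x, (Metric.ball (0 : Rn n) ρ).indicator
            (fun _ => ENNReal.ofReal (t ^ (-p - 1))) x ≤ G x t := by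
          intro x
          by_cases hx : x ∈ Metric.ball (0 : Rn n) ρ
          · have hxB : (x, t) ∈ B := by
              refine ⟨ht, ?_⟩
              simp only [max_eq_left ht0.le]
              rw [← hρn]
              exact pow_lt_pow_left₀ (by simpa using hx) (norm_nonneg _) (by omega)
            simp only [hG, Set.indicator_of_mem hx, Set.indicator_of_mem hxB]; rfl
          · simp [Set.indicator_of_notMem hx]
        refine le_trans ?_ (lintegral_mono hGt)
        rw [lintegral_indicator Metric.isOpen_ball.measurableSet, setLIntegral_const,
          Real.volume_pi_ball _ hρ0, ← ENNReal.ofReal_mul (by positivity)]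
        apply ENNReal.ofReal_le_ofReal
        simp only [Fintype.card_fin, mul_pow, hρn]
        rw [show -p - 1 = -(p + 1) by ring, Real.rpow_neg ht0.le, Real.rpow_add_one ht0.ne',
          div_div, div_eq_inv_mul]
        have h2n : (1:ℝ) ≤ 2 ^ n := one_le_pow₀ (by norm_num)
        have : Ψ t ≤ 2 ^ n * Ψ t := by nlinarith
        gcongr
    _ = ∫⁻ x, ∫⁻ t in Set.Ioi T, G x t := by
        rw [lintegral_lintegral_swap]
        exact (hGm.comp measurable_swap).aemeasurable
    _ ≤ ∫⁻ x, orliczMax Ψ f x ^ p := by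
        refine lintegral_mono fun x => ?_
        refine le_trans ?_ (tail_pow hp _ (hAm x) (fun t ht => ?_) (fun t ht => ?_))
        · have : (fun t => G x t) = (A x).indicator (fun t => ENNReal.ofReal (t ^ (-p - 1))) := by
            funext t; rfl
          rw [← lintegral_indicator (hAm x), this]
          exact lintegral_mono' Measure.restrict_le_self le_rfl
        · have := ht.1; linarith
        · have h0 : 0 < t := by have := ht.1; linarith
          have h2 := ht.2
          rw [max_eq_left h0.le] at h2
          exact max_lower hΨ h0 (hT t ht.1) x h2

/-- Theorem 3.1, Pérez: `M_Ψ` is bounded on `L^p` iff `Ψ ∈ B_p`. -/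
theorem statement19 {n : ℕ} (hn : 1 ≤ n) (p : ℝ) (hp : 1 < p)
    (Ψ : ℝ → ℝ) (hΨ : IsYoung Ψ) :
    (∃ C : ℝ, 0 < C ∧ ∀ f : Rn n → ℝ, MemLp f (ENNReal.ofReal p) volume →
      elpNorm p (fun _ => (1 : ℝ)) (orliczMax Ψ f)
        ≤ ENNReal.ofReal C * lpNorm p (fun _ => (1 : ℝ)) f) ↔
    BClass p Ψ := by
  constructor
  · rintro ⟨C, hC, h⟩
    apply lower hn hp hΨ
    set f : Rn n → ℝ := (Metric.closedBall (0 : Rn n) 1).indicator (fun _ => (1:ℝ)) with hf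
    have hfm : MemLp f (ENNReal.ofReal p) volume :=
      memLp_indicator_const _ Metric.isClosed_closedBall.measurableSet _
        (Or.inr measure_closedBall_lt_top.ne)
    have h1 := h f hfm
    have h2 : lpNorm p (fun _ => (1 : ℝ)) f < ⊤ := by
      unfold _root_.lpNorm
      refine ENNReal.rpow_lt_top_of_nonneg (by positivity) (ne_of_lt ?_)
      have : ∀ x, ENNReal.ofReal (|f x| ^ p * 1) ≤
          (Metric.closedBall (0 : Rn n) 1).indicator (fun _ => (1:ℝ≥0∞)) x := by
        intro x
        by_cases hx : x ∈ Metric.closedBall (0 : Rn n) 1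
        · simp only [hf, Set.indicator_of_mem hx]; simp
        · simp only [hf, Set.indicator_of_notMem hx]
          simp [Real.zero_rpow (by linarith : p ≠ 0)]
      refine (lintegral_mono this).trans_lt ?_
      rw [lintegral_indicator Metric.isClosed_closedBall.measurableSet]
      simp [measure_closedBall_lt_top]
    have h3 := h1.trans_lt (ENNReal.mul_lt_top ENNReal.ofReal_lt_top h2)
    unfold elpNorm at h3
    rw [ENNReal.rpow_lt_top_iff_of_pos (by positivity)] at h3
    simpa using h3
  · intro hB
    obtain ⟨K, hK, h⟩ := upper hn hp hΨ hB
    have hp0 : 0 < 1 / p := by positivity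
    refine ⟨(K ^ (1 / p)).toReal + 1, by positivity, fun f hf => ?_⟩
    have h1 := h f hf.1.aemeasurable
    unfold elpNorm _root_.lpNorm
    simp only [ENNReal.ofReal_one, mul_one]
    refine (ENNReal.rpow_le_rpow h1 hp0.le).trans ?_
    rw [ENNReal.mul_rpow_of_nonneg _ _ hp0.le]
    gcongr
    have hKt : K ^ (1 / p) ≠ ⊤ := ENNReal.rpow_ne_top_of_nonneg hp0.le hK
    rw [ENNReal.le_ofReal_iff_toReal_le hKt (by positivity)]
    linarith
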